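/- Let n ≥ 2 and let K ⊆ ℝⁿ be a compact convex set with nonempty interior whose boundary ∂K is C² in the following sense: there is a continuously differentiable map ν : ℝⁿ → ℝⁿ such that for every x ∈ ∂K, ‖ν(x)‖ = 1 and ⟨ν(x), y − x⟩ ≤ 0 for all y ∈ K (so ν(x) is the outward unit normal of a supporting hyperplane at x). Suppose there exists a constant c ∈ ℝ such that for all distinct x, y ∈ ∂K, |⟨ν(x), y − x⟩ · ⟨ν(y), x − y⟩| = c · ‖x − y‖^{n+1} (i.e., the quadratic Crofton integrand F(x,y) = |⟨ν(x), y−x⟩⟨ν(y), x−y⟩|/‖x−y‖^{n+1} is constant on ∂K × ∂K off the diagonal). Then n = 3 and ∂K is a round sphere: there exist p ∈ ℝ³ and r > 0 such that ∂K = {x ∈ ℝ³ : ‖x − p‖ = r}. -/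

import Mathlib

open MeasureTheory Metric Real Filter
open scoped ENNReal RealInnerProductSpace Topology

noncomputable section

/-- Euclidean space `ℝⁿ`. -/
abbrev En (n : ℕ) := EuclideanSpace ℝ (Fin n)

/-- The unit sphere `S^{n-1} ⊂ ℝⁿ`. -/
def unitSphere (n : ℕ) : Set (En n) := Metric.sphere 0 1

/-- The uniform probability (normalized surface) measure on the unit sphere. -/
def sigmaN (n : ℕ) : Measure (En n) :=
  (μH[(n : ℝ) - 1] (unitSphere n))⁻¹ •
    (μH[(n : ℝ) - 1] : Measure (En n)).restrict (unitSphere n)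

/-- The open unit disc in the hyperplane orthogonal to `v`. -/
def disc (n : ℕ) (v : En n) : Set (En n) := {z | ⟪v, z⟫ = 0 ∧ ‖z‖ < 1}

/-- Normalized `(n-1)`-dimensional Hausdorff measure on the disc `{z ∈ v⊥ : ‖z‖ < 1}`. -/
def lambdaN (n : ℕ) (v : En n) : Measure (En n) :=
  (μH[(n : ℝ) - 1] (disc n v))⁻¹ •
    (μH[(n : ℝ) - 1] : Measure (En n)).restrict (disc n v)

/-- The normalized kinematic measure on directed lines meeting the unit sphere,
parametrized by pairs `(v, z)` with `v` the direction and `z ∈ v⊥`, `‖z‖ < 1`. -/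
def kinematic (n : ℕ) : Measure (En n × En n) :=
  (sigmaN n).bind (fun v => (Measure.dirac v).prod (lambdaN n v))

/-- The entry point of the line parametrized by `(v, z)` in the unit sphere. -/
def Xpt (n : ℕ) (p : En n × En n) : En n := p.2 - Real.sqrt (1 - ‖p.2‖ ^ 2) • p.1

/-- The exit point of the line parametrized by `(v, z)` in the unit sphere. -/
def Ypt (n : ℕ) (p : En n × En n) : En n := p.2 + Real.sqrt (1 - ‖p.2‖ ^ 2) • p.1


/-- Second order Taylor expansion. -/
lemma taylor_two {n : ℕ} {g : En n → ℝ} {G : En n → En n} {A : En n →L[ℝ] En n} {x : En n}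
    (hg : ∀ᶠ y in 𝓝 x, HasFDerivAt g (innerSL ℝ (G y)) y) (hG : HasFDerivAt G A x) :
    (fun y => g y - g x - ⟪G x, y - x⟫ - (1/2) * ⟪A (y - x), y - x⟫)
      =o[𝓝 x] (fun y => ‖y - x‖ ^ 2) := by
  rw [Asymptotics.isLittleO_iff]
  intro ε hε
  have h1 := (Asymptotics.isLittleO_iff.1 hG.isLittleO) hε
  obtain ⟨δ, hδ, hball⟩ := Metric.eventually_nhds_iff.1 (hg.and h1)
  filter_upwards [Metric.ball_mem_nhds x hδ] with y hy
  have hmem : ∀ s ∈ Set.Icc (0:ℝ) 1, dist (x + s • (y - x)) x < δ := by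
    intro s hs
    rw [Metric.mem_ball, dist_eq_norm] at hy
    rw [dist_eq_norm, add_sub_cancel_left, norm_smul, Real.norm_eq_abs, abs_of_nonneg hs.1]
    nlinarith [norm_nonneg (y - x), hs.2]
  have hd : ∀ s ∈ Set.Icc (0:ℝ) 1, HasDerivAt
      (fun s : ℝ => g (x + s • (y - x)) - s * ⟪G x, y - x⟫ - (s ^ 2 / 2) * ⟪A (y - x), y - x⟫)
      (⟪G (x + s • (y - x)) - G x - A (s • (y - x)), y - x⟫) s := by
    intro s hs
    have e1 := (hball (hmem s hs)).1
    have e2 : HasDerivAt (fun s : ℝ => x + s • (y - x)) (y - x) s := by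
      simpa using ((hasDerivAt_id s).smul_const (y - x)).const_add x
    have e3 := e1.comp_hasDerivAt s e2
    have e4 := (e3.sub ((hasDerivAt_id s).mul_const ⟪G x, y - x⟫)).sub
      ((((hasDerivAt_id s).pow 2).div_const 2).mul_const ⟪A (y - x), y - x⟫)
    refine (e4.congr_deriv ?_)
    simp [inner_sub_left, inner_smul_left]
  have hb : ∀ s ∈ Set.Icc (0:ℝ) 1,
      ‖⟪G (x + s • (y - x)) - G x - A (s • (y - x)), y - x⟫‖ ≤ ε * ‖y - x‖ ^ 2 := by
    intro s hs
    have e1 := (hball (hmem s hs)).2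
    rw [add_sub_cancel_left] at e1
    refine (norm_inner_le_norm _ _).trans ?_
    have e2 : ‖s • (y - x)‖ ≤ ‖y - x‖ := by
      rw [norm_smul, Real.norm_eq_abs, abs_of_nonneg hs.1]
      nlinarith [norm_nonneg (y - x), hs.2]
    calc _ ≤ (ε * ‖y - x‖) * ‖y - x‖ := by gcongr; exact e1.trans (by gcongr)
      _ = _ := by ring
  have := (convex_Icc (0:ℝ) 1).norm_image_sub_le_of_norm_hasDerivWithin_le
    (fun s hs => (hd s hs).hasDerivWithinAt) hb (Set.left_mem_Icc.2 zero_le_one)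
    (Set.right_mem_Icc.2 zero_le_one)
  simp only [one_smul, zero_smul, add_zero, add_sub_cancel] at this
  simp only [Real.norm_eq_abs] at this ⊢
  rw [abs_of_nonneg (sq_nonneg ‖y - x‖)]
  calc _ = _ := by congr 1; ring
    _ ≤ _ := this
    _ = _ := by simp

/-- Ratio limit along a curve. -/
lemma curve_lim {n : ℕ} {x v : En n} {y : ℝ → En n} {B : En n →L[ℝ] En n} {R : En n → ℝ}
    (hy : HasDerivAt y v 0) (hy0 : y 0 = x)
    (hR : (fun z => R z - ⟪B (z - x), z - x⟫) =o[𝓝 x] (fun z => ‖z - x‖ ^ 2)) :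
    Tendsto (fun t => R (y t) / t ^ 2) (𝓝[>] 0) (𝓝 ⟪B v, v⟫) ∧
    Tendsto (fun t => ‖y t - x‖ / t) (𝓝[>] 0) (𝓝 ‖v‖) := by
  have hs : Tendsto (fun t : ℝ => t⁻¹ • (y t - x)) (𝓝[>] 0) (𝓝 v) := by
    have := hy.tendsto_slope_zero_right
    simpa [hy0] using this
  have hn : Tendsto (fun t => ‖y t - x‖ / t) (𝓝[>] 0) (𝓝 ‖v‖) := by
    refine hs.norm.congr' ?_
    filter_upwards [self_mem_nhdsWithin] with t ht
    have ht : 0 < t := ht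
    rw [norm_smul, norm_inv, Real.norm_eq_abs, abs_of_pos ht, div_eq_inv_mul]
  refine ⟨?_, hn⟩
  have hyx : Tendsto y (𝓝[>] 0) (𝓝 x) := by
    have := hy.continuousAt.tendsto.mono_left (nhdsWithin_le_nhds (s := Set.Ioi 0))
    rwa [hy0] at this
  have h1 : Tendsto (fun t => (R (y t) - ⟪B (y t - x), y t - x⟫) / ‖y t - x‖ ^ 2
      * (‖y t - x‖ / t) ^ 2) (𝓝[>] 0) (𝓝 (0 * ‖v‖ ^ 2)) :=
    ((hR.comp_tendsto hyx).tendsto_div_nhds_zero).mul (hn.pow 2)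
  have h2 : Tendsto (fun t : ℝ => ⟪B (t⁻¹ • (y t - x)), t⁻¹ • (y t - x)⟫) (𝓝[>] 0)
      (𝓝 ⟪B v, v⟫) := ((B.continuous.tendsto v).comp hs).inner hs
  have h3 := h1.add h2
  rw [zero_mul, zero_add] at h3
  refine h3.congr' ?_
  filter_upwards [self_mem_nhdsWithin, hyx.eventually (hR.bound one_pos)] with t ht hb
  have ht : 0 < t := ht
  simp only [map_smul, inner_smul_left, inner_smul_right]
  rcases eq_or_ne (y t) x with h | h
  · have : R x = 0 := by simpa [h] using hb
    simp [h, this]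
  · have : ‖y t - x‖ ≠ 0 := norm_ne_zero_iff.2 (sub_ne_zero.2 h)
    simp
    field_simp
    ring

structure Hyp (n : ℕ) (K : Set (En n)) (ν : En n → En n) : Prop where
  cpt : IsCompact K
  conv : Convex ℝ K
  zero : K ∈ 𝓝 (0 : En n)
  diff : Differentiable ℝ ν
  unit : ∀ x ∈ frontier K, ‖ν x‖ = 1
  supp : ∀ x ∈ frontier K, ∀ y ∈ K, ⟪ν x, y - x⟫ ≤ 0

/-- radial projection -/
def rp {n : ℕ} (K : Set (En n)) (x : En n) : En n := (gauge K x)⁻¹ • x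

/-- gradient of the gauge -/
def Gm {n : ℕ} (ν : En n → En n) (y : En n) : En n := (⟪ν y, y⟫)⁻¹ • ν y

namespace Hyp
variable {n : ℕ} {K : Set (En n)} {ν : En n → En n}

lemma gpos (h : Hyp n K ν) {x : En n} (hx : x ≠ 0) : 0 < gauge K x :=
  (gauge_pos (absorbent_nhds_zero h.zero)
    ((NormedSpace.isVonNBounded_iff ℝ).2 h.cpt.isBounded)).2 hx

lemma gfr (h : Hyp n K ν) {x : En n} : gauge K x = 1 ↔ x ∈ frontier K :=
  gauge_eq_one_iff_mem_frontier h.conv h.zero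

lemma rp_mem (h : Hyp n K ν) {x : En n} (hx : x ≠ 0) : rp K x ∈ frontier K := by
  rw [← h.gfr, rp, gauge_smul_of_nonneg (inv_nonneg.2 (gauge_nonneg x)), smul_eq_mul,
    inv_mul_cancel₀ (h.gpos hx).ne']

lemma ne_zero (h : Hyp n K ν) {x : En n} (hx : x ∈ frontier K) : x ≠ 0 := by
  rintro rfl
  rw [← h.gfr, gauge_zero] at hx
  exact zero_ne_one hx

lemma rp_self (h : Hyp n K ν) {x : En n} (hx : x ∈ frontier K) : rp K x = x := by
  rw [rp, h.gfr.2 hx, inv_one, one_smul]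

lemma smul_rp (h : Hyp n K ν) {x : En n} (hx : x ≠ 0) : gauge K x • rp K x = x := by
  rw [rp, smul_smul, mul_inv_cancel₀ (h.gpos hx).ne', one_smul]

lemma frK (h : Hyp n K ν) {x : En n} (hx : x ∈ frontier K) : x ∈ K :=
  h.cpt.isClosed.frontier_subset hx

lemma mu_pos (h : Hyp n K ν) {x : En n} (hx : x ∈ frontier K) : 0 < ⟪ν x, x⟫ := by
  obtain ⟨ε, hε, hb⟩ := Metric.mem_nhds_iff.1 h.zero
  have h1 : (ε / 2) • ν x ∈ K := by
    apply hb
    rw [Metric.mem_ball, dist_zero_right, norm_smul, h.unit x hx, Real.norm_eq_abs,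
      abs_of_pos (by positivity)]
    linarith
  have := h.supp x hx _ h1
  rw [inner_sub_right, inner_smul_right, real_inner_self_eq_norm_sq, h.unit x hx] at this
  linarith

lemma Gm_self (h : Hyp n K ν) {x : En n} (hx : x ∈ frontier K) : ⟪Gm ν x, x⟫ = 1 := by
  rw [Gm, inner_smul_left]
  exact inv_mul_cancel₀ (h.mu_pos hx).ne'

lemma G_self (h : Hyp n K ν) {x : En n} (hx : x ≠ 0) : ⟪Gm ν (rp K x), x⟫ = gauge K x := by
  have e : ⟪Gm ν (rp K x), gauge K x • rp K x⟫ = gauge K x := by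
    rw [inner_smul_right, h.Gm_self (h.rp_mem hx), mul_one]
  rwa [h.smul_rp hx] at e

lemma G_le (h : Hyp n K ν) {x y : En n} (hx : x ≠ 0) (hy : y ≠ 0) :
    ⟪Gm ν (rp K x), y⟫ ≤ gauge K y := by
  have h1 := h.supp _ (h.rp_mem hx) _ (h.frK (h.rp_mem hy))
  have h2 := h.mu_pos (h.rp_mem hx)
  rw [inner_sub_right] at h1
  conv_lhs => rw [← h.smul_rp hy]
  rw [inner_smul_right, Gm, inner_smul_left]
  simp only [conj_trivial]
  have : (⟪ν (rp K x), rp K x⟫)⁻¹ * ⟪ν (rp K x), rp K y⟫ ≤ 1 := by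
    rw [inv_mul_le_iff₀ h2]; linarith
  nlinarith [h.gpos hy]

lemma rp_cont (h : Hyp n K ν) {x : En n} (hx : x ≠ 0) : ContinuousAt (rp K) x :=
  ((continuous_gauge h.conv h.zero).continuousAt.inv₀ (h.gpos hx).ne').smul continuousAt_id

lemma Gm_diff (h : Hyp n K ν) {x : En n} (hx : x ∈ frontier K) :
    HasFDerivAt (Gm ν) ((⟪ν x, x⟫)⁻¹ • fderiv ℝ ν x +
      (fderiv ℝ (fun y => (⟪ν y, y⟫)⁻¹) x).smulRight (ν x)) x := by
  have h1 : DifferentiableAt ℝ (fun y => (⟪ν y, y⟫)⁻¹) x :=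
    ((h.diff x).inner ℝ differentiableAt_id).inv (h.mu_pos hx).ne'
  exact h1.hasFDerivAt.smul (h.diff x).hasFDerivAt

lemma gauge_diff (h : Hyp n K ν) {x : En n} (hx : x ≠ 0) :
    HasFDerivAt (gauge K) (innerSL ℝ (Gm ν (rp K x))) x := by
  have hc : ContinuousAt (fun y => Gm ν (rp K y)) x :=
    ContinuousAt.comp (g := Gm ν) (h.Gm_diff (h.rp_mem hx)).continuousAt (h.rp_cont hx)
  rw [hasFDerivAt_iff_isLittleO, Asymptotics.isLittleO_iff]
  intro ε hε
  filter_upwards [hc (Metric.ball_mem_nhds _ hε), isOpen_ne.mem_nhds hx] with y hy hy0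
  have hy : dist (Gm ν (rp K y)) (Gm ν (rp K x)) < ε := hy
  rw [dist_eq_norm] at hy
  have e1 := h.G_le hx hy0
  have e2 := h.G_le hy0 hx
  have e3 := h.G_self hx
  have e4 := h.G_self hy0
  have e5 := real_inner_le_norm (Gm ν (rp K y) - Gm ν (rp K x)) (y - x)
  simp only [innerSL_apply_apply]
  rw [Real.norm_eq_abs, abs_of_nonneg (by rw [inner_sub_right]; linarith)]
  refine le_trans ?_ (e5.trans (by gcongr))
  rw [inner_sub_left, inner_sub_right, inner_sub_right]
  linarith

/-- derivative of the radial projection -/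
def P (K : Set (En n)) (ν : En n → En n) (x : En n) : En n →L[ℝ] En n :=
  (gauge K x)⁻¹ • ContinuousLinearMap.id ℝ (En n) +
    (-((gauge K x) ^ 2)⁻¹ • innerSL ℝ (Gm ν (rp K x))).smulRight x

lemma rp_diff (h : Hyp n K ν) {x : En n} (hx : x ≠ 0) : HasFDerivAt (rp K) (P K ν x) x := by
  have h1 := (hasDerivAt_inv (h.gpos hx).ne').comp_hasFDerivAt x (h.gauge_diff hx)
  exact h1.smul (hasFDerivAt_id x)

lemma P_tan (h : Hyp n K ν) {x : En n} (hx : x ≠ 0) (v : En n) :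
    ⟪ν (rp K x), P K ν x v⟫ = 0 := by
  have h1 : ⟪Gm ν (rp K x), P K ν x v⟫ = 0 := by
    have := (h.gpos hx).ne'
    simp only [P, add_apply, smul_apply,
      ContinuousLinearMap.smulRight_apply, inner_add_right, inner_smul_right, h.G_self hx,
      innerSL_apply_apply, ContinuousLinearMap.id_apply, smul_eq_mul]
    field_simp
    ring
  rw [Gm, inner_smul_left] at h1
  exact (mul_eq_zero.1 h1).resolve_left (inv_ne_zero (h.mu_pos (h.rp_mem hx)).ne')

lemma P_of_tan (h : Hyp n K ν) {x : En n} (hx : x ∈ frontier K) {v : En n} (hv : ⟪ν x, v⟫ = 0) :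
    P K ν x v = v := by
  simp [P, h.rp_self hx, Gm, hv, h.gfr.2 hx]

lemma N_normal (h : Hyp n K ν) {x : En n} (hx : x ∈ frontier K) {v : En n} (hv : ⟪ν x, v⟫ = 0) :
    ⟪fderiv ℝ ν x v, ν x⟫ = 0 := by
  have h0 := h.ne_zero hx
  have h1 : HasFDerivAt (fun y => ν (rp K y)) ((fderiv ℝ ν x).comp (P K ν x)) x := by
    have := (h.diff (rp K x)).hasFDerivAt.comp x (h.rp_diff h0)
    rwa [h.rp_self hx] at this
  have h2 := h1.norm_sq
  have h3 : HasFDerivAt (fun y => ‖ν (rp K y)‖ ^ 2) (0 : En n →L[ℝ] ℝ) x := by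
    refine (hasFDerivAt_const (1:ℝ) x).congr_of_eventuallyEq ?_
    filter_upwards [isOpen_ne.mem_nhds h0] with y hy
    rw [h.unit _ (h.rp_mem hy), one_pow]
  have h4 := congrArg (fun L => L v) (h2.unique h3)
  simp only [h.rp_self hx] at h4
  simp [h.P_of_tan hx hv] at h4
  rw [real_inner_comm]; exact h4

/-- derivative of the gradient -/
lemma G_diff (h : Hyp n K ν) {x : En n} (hx : x ∈ frontier K) :
    ∃ A : En n →L[ℝ] En n, HasFDerivAt (fun y => Gm ν (rp K y)) A x ∧
      ∀ v, ⟪ν x, v⟫ = 0 → ∃ s : ℝ, A v = (⟪ν x, x⟫)⁻¹ • fderiv ℝ ν x v + s • ν x := by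
  have h1 := (h.Gm_diff (h.rp_mem (h.ne_zero hx))).comp x (h.rp_diff (h.ne_zero hx))
  rw [h.rp_self hx] at h1
  refine ⟨_, h1, fun v hv => ⟨fderiv ℝ (fun y => (⟪ν y, y⟫)⁻¹) x v, ?_⟩⟩
  simp [h.P_of_tan hx hv]

lemma N_symm (h : Hyp n K ν) {x : En n} (hx : x ∈ frontier K) {v w : En n} (hv : ⟪ν x, v⟫ = 0)
    (hw : ⟪ν x, w⟫ = 0) : ⟪fderiv ℝ ν x v, w⟫ = ⟪fderiv ℝ ν x w, v⟫ := by
  obtain ⟨A, hA, hA'⟩ := h.G_diff hx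
  have h1 : ∀ᶠ y in 𝓝 x, HasFDerivAt (gauge K) (innerSL ℝ (Gm ν (rp K y))) y := by
    filter_upwards [isOpen_ne.mem_nhds (h.ne_zero hx)] with y hy using h.gauge_diff hy
  have h2 : HasFDerivAt (fun y => innerSL ℝ (Gm ν (rp K y))) ((innerSL ℝ).comp A) x :=
    (innerSL ℝ (E := En n)).hasFDerivAt.comp x hA
  have h3 := second_derivative_symmetric_of_eventually_of_real h1 h2 v w
  obtain ⟨s, hs⟩ := hA' v hv
  obtain ⟨s', hs'⟩ := hA' w hw
  simp only [ContinuousLinearMap.comp_apply, innerSL_apply_apply, hs, hs', inner_add_left,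
    inner_smul_left, hv, hw, conj_trivial, mul_zero, add_zero] at h3
  exact mul_left_cancel₀ (inv_ne_zero (h.mu_pos hx).ne') h3

lemma limits (h : Hyp n K ν) {x : En n} (hx : x ∈ frontier K) {v : En n} (hv : ⟪ν x, v⟫ = 0) :
    ∃ y : ℝ → En n, Tendsto y (𝓝[>] 0) (𝓝 x) ∧ (∀ᶠ t in 𝓝[>] 0, y t ∈ frontier K) ∧
      Tendsto (fun t => ⟪ν x, y t - x⟫ / t ^ 2) (𝓝[>] 0) (𝓝 (-(⟪fderiv ℝ ν x v, v⟫ / 2))) ∧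
      Tendsto (fun t => ⟪ν (y t), x - y t⟫ / t ^ 2) (𝓝[>] 0)
        (𝓝 (-(⟪fderiv ℝ ν x v, v⟫ / 2))) ∧
      Tendsto (fun t => ‖y t - x‖ / t) (𝓝[>] 0) (𝓝 ‖v‖) := by
  have h0 := h.ne_zero hx
  obtain ⟨A, hA, hA'⟩ := h.G_diff hx
  have h1 : ∀ᶠ y in 𝓝 x, HasFDerivAt (gauge K) (innerSL ℝ (Gm ν (rp K y))) y := by
    filter_upwards [isOpen_ne.mem_nhds h0] with y hy using h.gauge_diff hy
  have hl : HasDerivAt (fun t : ℝ => x + t • v) v 0 := by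
    simpa using ((hasDerivAt_id (0:ℝ)).smul_const v).const_add x
  set y : ℝ → En n := fun t => rp K (x + t • v) with hy
  have hy0 : y 0 = x := by simp [hy, h.rp_self hx]
  have hyd : HasDerivAt y v 0 := by
    have e := h.rp_diff h0
    have : HasFDerivAt (rp K) (P K ν x) (x + (0:ℝ) • v) := by simpa using e
    have := this.comp_hasDerivAt 0 hl
    rwa [h.P_of_tan hx hv] at this
  have hne : ∀ᶠ t in 𝓝[>] (0:ℝ), x + t • v ≠ 0 := by
    apply Filter.Eventually.filter_mono nhdsWithin_le_nhds
    exact hl.continuousAt.eventually_ne (by simpa using h0)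
  have hfr : ∀ᶠ t in 𝓝[>] (0:ℝ), y t ∈ frontier K := by
    filter_upwards [hne] with t ht using h.rp_mem ht
  have hyx : Tendsto y (𝓝[>] 0) (𝓝 x) := by
    have := hyd.continuousAt.tendsto.mono_left (nhdsWithin_le_nhds (s := Set.Ioi 0))
    rwa [hy0] at this
  have hmu := (h.mu_pos hx)
  have hAv : ⟪A v, v⟫ = (⟪ν x, x⟫)⁻¹ * ⟪fderiv ℝ ν x v, v⟫ := by
    obtain ⟨s, hs⟩ := hA' v hv
    simp [hs, inner_add_left, inner_smul_left, hv]
  have T1 := taylor_two h1 hA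
  have T2 : (fun z => ⟪Gm ν (rp K z) - Gm ν (rp K x), z - x⟫ - ⟪A (z - x), z - x⟫)
      =o[𝓝 x] (fun z => ‖z - x‖ ^ 2) := by
    have e := hA.isLittleO
    rw [Asymptotics.isLittleO_iff] at e ⊢
    intro ε hε
    filter_upwards [e hε] with z hz
    rw [← inner_sub_left]
    refine (norm_inner_le_norm _ _).trans ?_
    rw [norm_pow, norm_norm, pow_two, ← mul_assoc]
    gcongr
  have L1 := curve_lim (R := fun z => gauge K z - gauge K x - ⟪Gm ν (rp K x), z - x⟫)
    (B := (1/2 : ℝ) • A) hyd hy0 (by simpa [inner_smul_left] using T1)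
  have L2 := curve_lim (R := fun z => ⟪Gm ν (rp K z) - Gm ν (rp K x), z - x⟫)
    (B := A) hyd hy0 T2
  refine ⟨y, hyx, hfr, ?_, ?_, L1.2⟩
  · have := L1.1.const_mul (-⟪ν x, x⟫)
    convert this.congr' ?_ using 2
    · simp [inner_smul_left, hAv]; field_simp
    · filter_upwards [hfr] with t ht
      rw [h.gfr.2 ht, h.gfr.2 hx, h.rp_self hx, Gm, inner_smul_left]
      simp only [conj_trivial]
      field_simp
      ring
  · have hmuc : Tendsto (fun t => -⟪ν (y t), y t⟫) (𝓝[>] 0) (𝓝 (-⟪ν x, x⟫)) :=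
      ((((h.diff.continuous.tendsto x).comp hyx).inner hyx)).neg
    have := hmuc.mul (L2.1.sub L1.1)
    convert this.congr' ?_ using 2
    · simp [inner_smul_left, hAv]; field_simp; ring
    · filter_upwards [hfr] with t ht
      have hm := h.mu_pos ht
      rw [h.gfr.2 ht, h.gfr.2 hx, h.rp_self hx, h.rp_self ht, inner_sub_left]
      have : ⟪Gm ν (y t), y t - x⟫ = -((⟪ν (y t), y t⟫)⁻¹ * ⟪ν (y t), x - y t⟫) := by
        rw [Gm, inner_smul_left, ← neg_sub x (y t), inner_neg_right]; simp
      rw [this]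
      field_simp
      ring


lemma N_nonneg (h : Hyp n K ν) {x : En n} (hx : x ∈ frontier K) {v : En n} (hv : ⟪ν x, v⟫ = 0) :
    0 ≤ ⟪fderiv ℝ ν x v, v⟫ := by
  obtain ⟨y, -, hfr, h1, -, -⟩ := h.limits hx hv
  have : -(⟪fderiv ℝ ν x v, v⟫ / 2) ≤ 0 := by
    refine le_of_tendsto h1 ?_
    filter_upwards [hfr] with t ht
    exact div_nonpos_of_nonpos_of_nonneg (h.supp x hx _ (h.frK ht)) (sq_nonneg t)
  linarith

lemma neg_point (h : Hyp n K ν) {x : En n} (hx : x ≠ 0) :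
    ∃ s : ℝ, 0 < s ∧ -(s • x) ∈ frontier K := by
  have hx' : -x ≠ 0 := neg_ne_zero.2 hx
  refine ⟨(gauge K (-x))⁻¹, inv_pos.2 (h.gpos hx'), ?_⟩
  have := h.rp_mem hx'
  rwa [rp, smul_neg] at this

lemma c_pos (h : Hyp n K ν) {x : En n} (hx : x ∈ frontier K) {c : ℝ}
    (hc : ∀ x ∈ frontier K, ∀ y ∈ frontier K, x ≠ y →
      |⟪ν x, y - x⟫ * ⟪ν y, x - y⟫| = c * ‖x - y‖ ^ (n + 1)) : 0 < c := by
  have h0 := h.ne_zero hx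
  obtain ⟨s, hs, hy⟩ := h.neg_point h0
  have hm := h.mu_pos hx
  have hm' := h.mu_pos hy
  have hne : x ≠ -(s • x) := by
    intro e
    have : (1 + s) • x = 0 := by rw [add_smul, one_smul]; exact add_eq_zero_iff_eq_neg.2 e
    rcases smul_eq_zero.1 this with h1 | h1
    · linarith
    · exact h0 h1
  have e := hc x hx _ hy hne
  set y := -(s • x) with hyd
  have e1 : y - x = -((1 + s) • x) := by rw [hyd, add_smul, one_smul]; abel
  have e2 : x - y = -((1 + s⁻¹) • y) := by
    rw [hyd, add_smul, one_smul, smul_neg, smul_smul, inv_mul_cancel₀ hs.ne', one_smul]; abel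
  have p1 : ⟪ν x, y - x⟫ ≠ 0 := by
    rw [e1, inner_neg_right, inner_smul_right]
    have : 0 < (1 + s) * ⟪ν x, x⟫ := by positivity
    linarith
  have p2 : ⟪ν y, x - y⟫ ≠ 0 := by
    rw [e2, inner_neg_right, inner_smul_right]
    have : 0 < (1 + s⁻¹) * ⟪ν y, y⟫ := by positivity
    linarith
  have p3 : 0 < c * ‖x - y‖ ^ (n + 1) := by
    rw [← e]; exact abs_pos.2 (mul_ne_zero p1 p2)
  exact pos_of_mul_pos_left p3 (by positivity)

/-- the limit form of the hypothesis -/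
lemma lim_eq (h : Hyp n K ν) {c : ℝ}
    (hc : ∀ x ∈ frontier K, ∀ y ∈ frontier K, x ≠ y →
      |⟪ν x, y - x⟫ * ⟪ν y, x - y⟫| = c * ‖x - y‖ ^ (n + 1))
    {x : En n} (hx : x ∈ frontier K) {v : En n} (hv : ⟪ν x, v⟫ = 0) (hv0 : v ≠ 0) :
    ∃ r : ℝ → ℝ, Tendsto r (𝓝[>] 0) (𝓝 0) ∧
      Tendsto (fun t => r t / t) (𝓝[>] 0) (𝓝 ‖v‖) ∧
      Tendsto (fun t => c * r t ^ (n + 1) / t ^ 4) (𝓝[>] 0)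
        (𝓝 ((⟪fderiv ℝ ν x v, v⟫ / 2) ^ 2)) := by
  obtain ⟨y, hyx, hfr, h1, h2, h3⟩ := h.limits hx hv
  refine ⟨fun t => ‖y t - x‖, ?_, h3, ?_⟩
  · simpa using (hyx.sub_const x).norm
  · have h4 := (h1.mul h2).abs
    have e : |-(⟪fderiv ℝ ν x v, v⟫ / 2) * -(⟪fderiv ℝ ν x v, v⟫ / 2)|
        = (⟪fderiv ℝ ν x v, v⟫ / 2) ^ 2 := by
      rw [neg_mul_neg, ← pow_two, abs_of_nonneg (sq_nonneg _)]
    rw [e] at h4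
    refine h4.congr' ?_
    have hpos : 0 < ‖v‖ := norm_pos_iff.2 hv0
    filter_upwards [hfr, self_mem_nhdsWithin, h3.eventually (lt_mem_nhds hpos)] with t ht ht0 hr
    have ht0 : 0 < t := ht0
    have hne : x ≠ y t := by
      intro e
      rw [← e] at hr
      simp at hr
    have := hc x hx _ ht hne
    rw [norm_sub_rev (y t) x, ← this, div_mul_div_comm, abs_div]
    congr 1
    rw [abs_of_pos (by positivity)]; ring

lemma exists_tan (hn : 2 ≤ n) (u : En n) : ∃ v : En n, ⟪u, v⟫ = 0 ∧ v ≠ 0 := by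
  by_contra! hcon
  have hbot : (ℝ ∙ u)ᗮ = ⊥ := by
    rw [Submodule.eq_bot_iff]
    intro v hv
    exact hcon v (Submodule.mem_orthogonal_singleton_iff_inner_right.1 hv)
  have h1 := (ℝ ∙ u).finrank_add_finrank_orthogonal
  rw [hbot, finrank_bot, finrank_euclideanSpace_fin] at h1
  have h2 := (finrank_span_le_card (R := ℝ) ({u} : Set (En n)))
  simp at h2
  omega

lemma three_le (h : Hyp n K ν) (hn : 2 ≤ n) {c : ℝ}
    (hc : ∀ x ∈ frontier K, ∀ y ∈ frontier K, x ≠ y →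
      |⟪ν x, y - x⟫ * ⟪ν y, x - y⟫| = c * ‖x - y‖ ^ (n + 1))
    {x : En n} (hx : x ∈ frontier K) : 3 ≤ n := by
  by_contra hlt
  have hn2 : n = 2 := by omega
  obtain ⟨v, hv, hv0⟩ := exists_tan hn (ν x)
  obtain ⟨r, -, h2, h3⟩ := h.lim_eq hc hx hv hv0
  have hcp := h.c_pos hx hc
  have ht : Tendsto (fun t : ℝ => t) (𝓝[>] 0) (𝓝 0) := nhdsWithin_le_nhds
  have h4 := h3.mul ht
  have h5 := (h2.pow 3).const_mul c
  have h6 : Tendsto (fun t => c * (r t / t) ^ 3) (𝓝[>] 0)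
      (𝓝 ((⟪fderiv ℝ ν x v, v⟫ / 2) ^ 2 * 0)) := by
    refine h4.congr' ?_
    filter_upwards [self_mem_nhdsWithin] with t ht0
    have ht0 : 0 < t := ht0
    rw [hn2]
    field_simp
  have h7 := tendsto_nhds_unique h5 h6
  have : 0 < c * ‖v‖ ^ 3 := by have := norm_pos_iff.2 hv0; positivity
  rw [mul_zero] at h7
  linarith

lemma N_quad (h : Hyp n K ν) (hn : 3 ≤ n) {c : ℝ}
    (hc : ∀ x ∈ frontier K, ∀ y ∈ frontier K, x ≠ y →
      |⟪ν x, y - x⟫ * ⟪ν y, x - y⟫| = c * ‖x - y‖ ^ (n + 1))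
    {x : En n} (hx : x ∈ frontier K) {v : En n} (hv : ⟪ν x, v⟫ = 0) :
    ⟪fderiv ℝ ν x v, v⟫ = 2 * √(c * 0 ^ (n - 3)) * ‖v‖ ^ 2 := by
  rcases eq_or_ne v 0 with rfl | hv0
  · simp
  obtain ⟨r, h1, h2, h3⟩ := h.lim_eq hc hx hv hv0
  have hcp := h.c_pos hx hc
  have h5 := ((h2.pow 4).const_mul c).mul (h1.pow (n - 3))
  have h6 : Tendsto (fun t => c * r t ^ (n + 1) / t ^ 4) (𝓝[>] 0)
      (𝓝 (c * ‖v‖ ^ 4 * 0 ^ (n - 3))) := by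
    refine h5.congr fun t => ?_
    obtain ⟨k, rfl⟩ := Nat.exists_eq_add_of_le hn
    rw [Nat.add_sub_cancel_left, div_pow]
    ring
  have h7 := tendsto_nhds_unique h3 h6
  have h8 := h.N_nonneg hx hv
  have hz : 0 ≤ c * 0 ^ (n - 3) := by positivity
  have h9 : (⟪fderiv ℝ ν x v, v⟫) ^ 2 = (2 * √(c * 0 ^ (n - 3)) * ‖v‖ ^ 2) ^ 2 := by
    rw [mul_pow, mul_pow, Real.sq_sqrt hz]
    linarith
  exact (pow_left_inj₀ h8 (by positivity) two_ne_zero).1 h9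

lemma N_eq (h : Hyp n K ν) {l : ℝ} {x : En n} (hx : x ∈ frontier K)
    (hl : ∀ v, ⟪ν x, v⟫ = 0 → ⟪fderiv ℝ ν x v, v⟫ = l * ‖v‖ ^ 2) {v : En n}
    (hv : ⟪ν x, v⟫ = 0) : fderiv ℝ ν x v = l • v := by
  have hpol : ∀ w, ⟪ν x, w⟫ = 0 → ⟪fderiv ℝ ν x v - l • v, w⟫ = 0 := by
    intro w hw
    have e1 := hl v hv
    have e2 := hl w hw
    have e3 := hl (v + w) (by rw [inner_add_right, hv, hw, add_zero])
    have e4 := h.N_symm hx hv hw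
    rw [norm_add_sq_real, map_add, inner_add_left, inner_add_right, inner_add_right] at e3
    rw [inner_sub_left, inner_smul_left]
    simp only [conj_trivial]
    linarith
  have hw : ⟪ν x, fderiv ℝ ν x v - l • v⟫ = 0 := by
    rw [inner_sub_right, inner_smul_right, hv, real_inner_comm, h.N_normal hx hv]
    simp
  exact sub_eq_zero.1 (inner_self_eq_zero.1 (hpol _ hw))

lemma affine (h : Hyp n K ν) (hn : 2 ≤ n) {l : ℝ}
    (hl : ∀ x ∈ frontier K, ∀ v, ⟪ν x, v⟫ = 0 → fderiv ℝ ν x v = l • v) :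
    ∃ q : En n, ∀ x ∈ frontier K, ν x = l • x + q := by
  have hd : ∀ x : En n, x ≠ 0 → HasFDerivAt (fun y => ν (rp K y) - l • rp K y)
      (0 : En n →L[ℝ] En n) x := by
    intro x hx
    have h1 := ((h.diff (rp K x)).hasFDerivAt.comp x (h.rp_diff hx)).sub
      ((h.rp_diff hx).const_smul l)
    refine h1.congr_fderiv ?_
    ext1 v
    simp [hl _ (h.rp_mem hx) _ (h.P_tan hx v)]
  have hconn : IsConnected ({0}ᶜ : Set (En n)) := by
    apply isConnected_compl_singleton_of_one_lt_rank
    rw [← Module.finrank_eq_rank, finrank_euclideanSpace_fin]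
    exact_mod_cast hn
  obtain ⟨x0, hx0⟩ := hconn.nonempty
  refine ⟨ν (rp K x0) - l • rp K x0, fun x hx => ?_⟩
  have := isOpen_compl_singleton.is_const_of_fderiv_eq_zero (𝕜 := ℝ) hconn.isPreconnected
    (fun y hy => (hd y hy).differentiableAt.differentiableWithinAt)
    (fun y hy => (hd y hy).fderiv) (h.ne_zero hx) hx0
  simp only [h.rp_self hx] at this
  rw [← this]; abel

lemma main (h : Hyp n K ν) (hn : 2 ≤ n) {c : ℝ}
    (hc : ∀ x ∈ frontier K, ∀ y ∈ frontier K, x ≠ y →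
      |⟪ν x, y - x⟫ * ⟪ν y, x - y⟫| = c * ‖x - y‖ ^ (n + 1)) :
    n = 3 ∧ ∃ (p : En n) (r : ℝ), 0 < r ∧ frontier K = Metric.sphere p r := by
  obtain ⟨u, -, hu⟩ := exists_tan hn (0 : En n)
  have hx := h.rp_mem hu
  set x := rp K u
  have h3 := h.three_le hn hc hx
  have hcp := h.c_pos hx hc
  obtain ⟨q, hq⟩ := h.affine hn (l := 2 * √(c * 0 ^ (n - 3)))
    (fun x hx v hv => h.N_eq hx (fun v hv => h.N_quad h3 hc hx hv) hv)
  have hn3 : n = 3 := by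
    by_contra hne
    have : n - 3 ≠ 0 := by omega
    simp only [zero_pow this, mul_zero, Real.sqrt_zero, zero_smul, zero_add] at hq
    have hq1 : ‖q‖ = 1 := by rw [← hq x hx]; exact h.unit x hx
    obtain ⟨s, hs, hm⟩ := h.neg_point (x := q) (by rintro rfl; simp at hq1)
    have := h.mu_pos hm
    rw [hq _ hm, inner_neg_right, inner_smul_right, real_inner_self_eq_norm_sq, hq1] at this
    linarith
  refine ⟨hn3, ?_⟩
  have hl : 0 < 2 * √(c * 0 ^ (n - 3)) := by simp [hn3, hcp]
  generalize 2 * √(c * 0 ^ (n - 3)) = l at hl hq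
  have hsq : ∀ y : En n, ‖l • y + q‖ ^ 2 = l ^ 2 * ‖y‖ ^ 2 + 2 * l * ⟪y, q⟫ + ‖q‖ ^ 2 := by
    intro y
    rw [norm_add_sq_real, norm_smul, inner_smul_left, mul_pow, Real.norm_eq_abs, sq_abs]
    simp; ring
  have hfr : ∀ y ∈ frontier K, ‖l • y + q‖ ^ 2 = 1 := by
    intro y hy
    rw [← hq y hy, h.unit y hy, one_pow]
  have hq1 : ‖q‖ ^ 2 < 1 := by
    have h0 := h.ne_zero hx
    obtain ⟨s, hs, hm⟩ := h.neg_point h0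
    have e1 := hfr _ hx
    have e2 := hfr _ hm
    rw [hsq] at e1 e2
    rw [norm_neg, norm_smul, inner_neg_left, inner_smul_left, Real.norm_eq_abs, mul_pow,
      sq_abs] at e2
    simp only [conj_trivial] at e2
    have hxp : 0 < l ^ 2 * ‖x‖ ^ 2 := by have := norm_pos_iff.2 h0; positivity
    nlinarith [mul_pos hs hxp, mul_pos hs (mul_pos hs hxp)]
  refine ⟨-(l⁻¹ • q), l⁻¹, inv_pos.2 hl, ?_⟩
  have hsph : ∀ y : En n, y ∈ Metric.sphere (-(l⁻¹ • q)) l⁻¹ ↔ ‖l • y + q‖ ^ 2 = 1 := by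
    intro y
    have : l • y + q = l • (y - -(l⁻¹ • q)) := by
      rw [sub_neg_eq_add, smul_add, smul_smul, mul_inv_cancel₀ hl.ne', one_smul]
    rw [mem_sphere_iff_norm, this, norm_smul, Real.norm_eq_abs, abs_of_pos hl,
      pow_eq_one_iff_of_nonneg (by positivity) two_ne_zero, mul_comm,
      eq_comm, inv_eq_one_div, div_eq_iff hl.ne', eq_comm]
  ext y
  rw [hsph]
  refine ⟨hfr y, fun hy => ?_⟩
  have hy0 : y ≠ 0 := by
    rintro rfl
    rw [smul_zero, zero_add] at hy
    linarith
  have hz := h.rp_mem hy0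
  have hz0 := h.ne_zero hz
  have hyz := h.smul_rp hy0
  have hs := h.gpos hy0
  set z := rp K y
  generalize gauge K y = s at hyz hs
  have e1 := hfr _ hz
  rw [← hyz] at hy
  rw [hsq] at e1 hy
  rw [norm_smul, inner_smul_left, Real.norm_eq_abs, mul_pow, sq_abs] at hy
  simp only [conj_trivial] at hy
  have hxp : 0 < l ^ 2 * ‖z‖ ^ 2 := by have := norm_pos_iff.2 hz0; positivity
  have e3 : (s - 1) * (s * (l ^ 2 * ‖z‖ ^ 2) + (1 - ‖q‖ ^ 2)) = 0 := by
    linear_combination hy - s * e1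
  have e4 : 0 < s * (l ^ 2 * ‖z‖ ^ 2) + (1 - ‖q‖ ^ 2) := by
    have := mul_pos hs hxp; linarith
  have : s = 1 := by linarith [(mul_eq_zero.1 e3).resolve_right e4.ne']
  rw [← hyz, this, one_smul]
  exact hz

end Hyp

/-- If `K ⊆ ℝⁿ` is a compact convex body with `C²` boundary whose quadratic Crofton
integrand `F(x,y) = |⟨ν(x), y-x⟩·⟨ν(y), x-y⟩| / ‖x-y‖^{n+1}` is constant on
`∂K × ∂K` off the diagonal, then `n = 3` and `∂K` is a round sphere. -/
theorem constant_crofton_integrand_implies_sphere (n : ℕ) (hn : 2 ≤ n)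
    (K : Set (En n)) (hK : IsCompact K) (hKconv : Convex ℝ K)
    (hKint : (interior K).Nonempty)
    (ν : En n → En n) (hν : ContDiff ℝ 1 ν)
    (hνnorm : ∀ x ∈ frontier K, ‖ν x‖ = 1)
    (hνsupp : ∀ x ∈ frontier K, ∀ y ∈ K, ⟪ν x, y - x⟫ ≤ 0)
    (c : ℝ)
    (hconst : ∀ x ∈ frontier K, ∀ y ∈ frontier K, x ≠ y →
      |⟪ν x, y - x⟫ * ⟪ν y, x - y⟫| = c * ‖x - y‖ ^ (n + 1)) :
    n = 3 ∧ ∃ (p : En n) (r : ℝ), 0 < r ∧ frontier K = Metric.sphere p r := by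
  obtain ⟨z, hz⟩ := hKint
  let e : En n ≃ₜ En n := Homeomorph.addRight z
  have he : ∀ x, e x = x + z := fun x => rfl
  have hfr : frontier (e ⁻¹' K) = e ⁻¹' frontier K := (e.preimage_frontier K).symm
  have H : Hyp n (e ⁻¹' K) (fun x => ν (x + z)) :=
    { cpt := e.isCompact_preimage.2 hK
      conv := by
        have := hKconv.translate_preimage_left z
        exact this
      zero := by
        apply e.continuous.continuousAt.preimage_mem_nhds
        rw [he, zero_add]
        exact mem_interior_iff_mem_nhds.1 hz
      diff := (hν.differentiable one_ne_zero).comp (differentiable_id.add_const z)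
      unit := by
        intro x hx
        rw [hfr] at hx
        exact hνnorm _ hx
      supp := by
        intro x hx y hy
        rw [hfr] at hx
        have := hνsupp _ hx _ hy
        rwa [he, he, add_sub_add_right_eq_sub] at this }
  obtain ⟨h3, p, r, hr, hs⟩ := H.main hn (c := c) (by
    intro x hx y hy hxy
    rw [hfr] at hx hy
    have := hconst _ hx _ hy (e.injective.ne hxy)
    rwa [he, he, add_sub_add_right_eq_sub, add_sub_add_right_eq_sub] at this)
  refine ⟨h3, p + z, r, hr, ?_⟩
  rw [hfr] at hs
  ext y
  have h1 : y - z ∈ e ⁻¹' frontier K ↔ y - z ∈ Metric.sphere p r := by rw [hs]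
  rw [Set.mem_preimage, he, sub_add_cancel] at h1
  rw [h1, mem_sphere_iff_norm, mem_sphere_iff_norm, sub_sub, add_comm z p]

end
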